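/- Let Ω ⊆ ℝⁿ be a bounded convex domain with diameter d_Ω. Then for 1 ≤ q ≤ n and admissible r, the Sobolev–Poincaré constant satisfies B_{r,q}(Ω) ≤ (d_Ω^n/(n|Ω|)) · ((1 − 1/q + 1/r)/(1/n − 1/q + 1/r))^{1 − 1/q + 1/r} · ω_n^{1 − 1/n} · |Ω|^{1/n − 1/q + 1/r}, where ω_n = 2π^{n/2}/(nΓ(n/2)) is the volume of the unit ball. -/

import Mathlib

open MeasureTheory ENNReal Metric

/-- `ω_n = 2π^{n/2}/(nΓ(n/2))`, the volume of the unit ball in `ℝⁿ`. -/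
noncomputable def unitBallVolume (n : ℕ) : ℝ :=
  2 * Real.pi ^ ((n : ℝ) / 2) / ((n : ℝ) * Real.Gamma ((n : ℝ) / 2))

namespace SPaux

set_option linter.style.haveILetI false

abbrev EE (n : ℕ) := EuclideanSpace ℝ (Fin n)

lemma rpow_anti {a b : ℝ≥0∞} {α : ℝ} (hα : 0 ≤ α) (h : a ≤ b) : b ^ (-α) ≤ a ^ (-α) := by
  rw [ENNReal.rpow_neg, ENNReal.rpow_neg]
  exact ENNReal.inv_le_inv.2 (ENNReal.rpow_le_rpow h hα)

lemma ubv_pos (n : ℕ) (hn : 2 ≤ n) : 0 < unitBallVolume n := by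
  have : (0:ℝ) < n := by positivity
  have := Real.Gamma_pos_of_pos (s := (n:ℝ)/2) (by positivity)
  unfold unitBallVolume
  positivity

lemma vol_unit_ball (n : ℕ) (hn : 2 ≤ n) :
    volume (ball (0 : EE n) 1) = ENNReal.ofReal (unitBallVolume n) := by
  have hn0 : (0:ℝ) < n := by positivity
  haveI : Nonempty (Fin n) := ⟨⟨0, by omega⟩⟩
  rw [EuclideanSpace.volume_ball]
  simp only [ENNReal.ofReal_one, one_pow, one_mul, Fintype.card_fin]
  congr 1
  unfold unitBallVolume
  rw [Real.Gamma_add_one (by positivity)]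
  have h1 : √Real.pi ^ n = Real.pi ^ ((n:ℝ)/2) := by
    rw [Real.sqrt_eq_rpow, ← Real.rpow_natCast, ← Real.rpow_mul Real.pi_pos.le]
    congr 1; ring
  rw [h1]
  have := Real.Gamma_pos_of_pos (s := (n:ℝ)/2) (by positivity)
  field_simp

lemma vol_ball (n : ℕ) (hn : 2 ≤ n) (x : EE n) (R : ℝ) (hR : 0 ≤ R) :
    volume (ball x R) = ENNReal.ofReal (unitBallVolume n * R ^ n) := by
  haveI : Nonempty (Fin n) := ⟨⟨0, by omega⟩⟩
  rw [Measure.addHaar_ball _ _ hR, vol_unit_ball n hn, ← ENNReal.ofReal_mul (by positivity)]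
  simp [mul_comm]

lemma radial (n : ℕ) (hn : 2 ≤ n) (R : ℝ) (F : ℝ → ℝ) (hF : ∀ y, 0 ≤ F y)
    (hi : IntegrableOn (fun y : ℝ => y ^ (n - 1) * F y) (Set.Ioo 0 R)) :
    ∫⁻ x in ball (0 : EE n) R, ENNReal.ofReal (F ‖x‖)
      = ENNReal.ofReal (n * unitBallVolume n * ∫ y in Set.Ioo 0 R, y ^ (n - 1) * F y) := by
  haveI : Nonempty (Fin n) := ⟨⟨0, by omega⟩⟩
  have hdim : Module.finrank ℝ (EE n) = n := by simp 
  have hset : Set.Ioi (0:ℝ) ∩ Set.Iio R = Set.Ioo 0 R := rfl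
  have hind : (fun y : ℝ => y ^ (n-1) * (Set.Iio R).indicator F y)
      = (Set.Iio R).indicator (fun y : ℝ => y ^ (n - 1) * F y) := by
    ext y; by_cases h : y ∈ Set.Iio R <;> simp [h]
  have h1 : Integrable (fun x : EE n => (Set.Iio R).indicator F ‖x‖) volume := by
    rw [integrable_fun_norm_addHaar volume, hdim]
    simp only [smul_eq_mul, hind]
    rw [IntegrableOn, integrable_indicator_iff measurableSet_Iio, IntegrableOn,
      Measure.restrict_restrict measurableSet_Iio, Set.inter_comm, hset]
    exact hi
  have h2 := integral_fun_norm_addHaar (volume : Measure (EE n)) ((Set.Iio R).indicator F)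
  rw [hdim] at h2
  simp only [smul_eq_mul, hind, nsmul_eq_mul] at h2
  rw [setIntegral_indicator measurableSet_Iio, hset, measureReal_def, vol_unit_ball n hn,
    ENNReal.toReal_ofReal (ubv_pos n hn).le] at h2
  rw [mul_assoc, ← h2, ofReal_integral_eq_lintegral_ofReal h1
    (Filter.Eventually.of_forall fun x => Set.indicator_nonneg (fun y _ => hF y) _),
    ← lintegral_indicator measurableSet_ball]
  congr 1; ext x
  by_cases h : ‖x‖ < R <;> simp [h, Set.indicator]

/-- volume-to-radius rearrangement -/
lemma rearr (n : ℕ) (hn : 2 ≤ n) (A : Set (EE n)) (hA : MeasurableSet A)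
    (R α : ℝ) (hR : 0 < R) (hV : volume A = ENNReal.ofReal (unitBallVolume n * R ^ n))
    (hα0 : 0 ≤ α) (hα : α < n) (x : EE n) :
    ∫⁻ y in A, ‖y - x‖ₑ ^ (-α) ≤
      ENNReal.ofReal (n / (n - α) * unitBallVolume n * R ^ ((n:ℝ) - α)) := by
  haveI : Nonempty (Fin n) := ⟨⟨0, by omega⟩⟩
  set B := ball x R
  have hB : MeasurableSet B := measurableSet_ball
  have hVB : volume B = volume A := by rw [hV]; exact vol_ball n hn x R hR.le
  have hfin : volume A ≠ ⊤ := by rw [hV]; exact ENNReal.ofReal_ne_top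
  set k : EE n → ℝ≥0∞ := fun y => ‖y - x‖ₑ ^ (-α) with hk
  set c : ℝ≥0∞ := ENNReal.ofReal R ^ (-α)
  have hdiff : volume (A \ B) = volume (B \ A) := by
    have e1 := measure_sdiff_add_inter (μ := volume) A hB
    have e2 := measure_sdiff_add_inter (μ := volume) B hA
    rw [Set.inter_comm, hVB, ← e1] at e2
    have : volume (A ∩ B) ≠ ⊤ := ne_top_of_le_ne_top hfin (measure_mono Set.inter_subset_left)
    exact ((ENNReal.add_left_inj this).1 e2).symm
  have s1 : ∫⁻ y in A \ B, k y ≤ c * volume (A \ B) := by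
    rw [← setLIntegral_const]
    refine setLIntegral_mono measurable_const fun y hy => ?_
    have : R ≤ ‖y - x‖ := by
      have := hy.2; simp only [B, mem_ball, not_lt, dist_eq_norm] at this; exact this
    refine rpow_anti hα0 ?_
    rw [← ofReal_norm]; exact ENNReal.ofReal_le_ofReal this
  have hkm : Measurable k := by fun_prop
  have s2 : c * volume (B \ A) ≤ ∫⁻ y in B \ A, k y := by
    rw [← setLIntegral_const]
    refine setLIntegral_mono hkm fun y hy => ?_
    have : ‖y - x‖ ≤ R := by
      have := hy.1; simp only [B, mem_ball, dist_eq_norm] at this; exact this.le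
    refine rpow_anti hα0 ?_
    rw [← ofReal_norm]; exact ENNReal.ofReal_le_ofReal this
  have s3 : ∫⁻ y in A, k y ≤ ∫⁻ y in B, k y := by
    rw [← lintegral_inter_add_sdiff k A hB, ← lintegral_inter_add_sdiff k B hA, Set.inter_comm B A]
    exact add_le_add le_rfl (s1.trans (hdiff ▸ s2))
  refine s3.trans (le_of_eq ?_)
  have s4 : ∫⁻ y in B, k y = ∫⁻ y in ball (0:EE n) R, ENNReal.ofReal (|‖y‖| ^ (-α)) := by
    rw [← lintegral_indicator hB, ← lintegral_indicator measurableSet_ball,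
      ← lintegral_add_right_eq_self _ x]
    refine lintegral_congr_ae ?_
    have h0 : ∀ᵐ y : EE n, y ≠ 0 := by
      rw [ae_iff]; simp
    filter_upwards [h0] with y hy
    have hy' : 0 < ‖y‖ := norm_pos_iff.2 hy
    have : ‖y‖ₑ ^ (-α) = ENNReal.ofReal (|‖y‖| ^ (-α)) := by
      rw [← ofReal_norm, ENNReal.ofReal_rpow_of_pos hy', abs_of_pos hy']
    by_cases h : ‖y‖ < R <;> simp [h, Set.indicator, B, dist_eq_norm, k, this]
  have hne : ∀ y ∈ Set.Ioo 0 R, y ^ (n - 1) * |y| ^ (-α) = y ^ ((n:ℝ) - 1 - α) := by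
    intro y hy
    rw [abs_of_pos hy.1, ← Real.rpow_natCast, ← Real.rpow_add hy.1, Nat.cast_sub (by omega)]
    congr 1; push_cast; ring
  have hint : IntegrableOn (fun y : ℝ => y ^ ((n:ℝ) - 1 - α)) (Set.Ioo 0 R) := by
    have := intervalIntegral.intervalIntegrable_rpow' (a := 0) (b := R) (r := (n:ℝ) - 1 - α)
      (by linarith)
    rw [intervalIntegrable_iff_integrableOn_Ioo_of_le hR.le] at this
    exact this
  rw [s4, radial n hn R (fun y => |y| ^ (-α)) (fun y => by positivity)
    (hint.congr_fun (fun y hy => (hne y hy).symm) measurableSet_Ioo)]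
  rw [setIntegral_congr_fun measurableSet_Ioo hne, ← integral_Ioc_eq_integral_Ioo,
    ← intervalIntegral.integral_of_le hR.le, integral_rpow (Or.inl (by linarith))]
  congr 1
  have h3 : (n:ℝ) - 1 - α + 1 = n - α := by ring
  rw [h3, Real.zero_rpow (by linarith)]
  ring

lemma ball_W (n : ℕ) (hn : 2 ≤ n) (d : ℝ) (hd : 0 < d) :
    ∫⁻ x in ball (0 : EE n) d, ENNReal.ofReal (d - ‖x‖) =
      ENNReal.ofReal (unitBallVolume n * d ^ (n + 1) / (n + 1)) := by
  have hc : Continuous (fun y : ℝ => y ^ (n - 1) * max (d - y) 0) := by fun_prop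
  have h0 := radial n hn d (fun y => max (d - y) 0) (fun y => le_max_right _ _)
    ((hc.integrableOn_Icc (a := 0) (b := d)).mono_set Set.Ioo_subset_Icc_self)
  have h1 : ∀ a : ℝ, ENNReal.ofReal (max a 0) = ENNReal.ofReal a := by
    intro a; simp
  simp only [h1] at h0
  rw [h0]
  congr 1
  obtain ⟨m, rfl⟩ : ∃ m, n = m + 1 := ⟨n - 1, by omega⟩
  have h2 : ∀ y ∈ Set.Ioo 0 d, y ^ (m + 1 - 1) * max (d - y) 0 = d * y ^ m - y ^ (m+1) := by
    intro y hy
    rw [max_eq_left (by linarith [hy.2])]; simp; ring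
  rw [setIntegral_congr_fun measurableSet_Ioo h2, ← integral_Ioc_eq_integral_Ioo,
    ← intervalIntegral.integral_of_le hd.le, intervalIntegral.integral_sub
      (by apply Continuous.intervalIntegrable; fun_prop)
      (by apply Continuous.intervalIntegrable; fun_prop)]
  simp
  field_simp
  ring

lemma ftc {n : ℕ} {Ω : Set (EE n)} (ho : IsOpen Ω) (hc : Convex ℝ Ω) {f : EE n → ℝ}
    (hf : DifferentiableOn ℝ f Ω) {x y : EE n} (hx : x ∈ Ω) (hy : y ∈ Ω) :
    ‖f y - f x‖ₑ ≤ ‖y - x‖ₑ * ∫⁻ τ in Set.Ioc (0:ℝ) 1, ‖fderiv ℝ f (x + τ • (y - x))‖ₑ := by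
  set φ' : ℝ → ℝ := fun τ => fderiv ℝ f (x + τ • (y - x)) (y - x) with hφ'
  have hm : Measurable φ' := by
    have h1 := measurable_fderiv ℝ f
    have h2 : Measurable (fun τ : ℝ => fderiv ℝ f (x + τ • (y - x))) :=
      h1.comp (by fun_prop)
    exact (ContinuousLinearMap.apply ℝ ℝ (y - x)).measurable.comp h2
  have hle : ∫⁻ τ in Set.Ioc (0:ℝ) 1, ‖φ' τ‖ₑ ≤
      ‖y - x‖ₑ * ∫⁻ τ in Set.Ioc (0:ℝ) 1, ‖fderiv ℝ f (x + τ • (y - x))‖ₑ := by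
    rw [← lintegral_const_mul']
    · refine lintegral_mono fun τ => ?_
      rw [mul_comm]
      exact ContinuousLinearMap.le_opENorm _ _
    · exact enorm_ne_top
  refine le_trans ?_ hle
  by_cases htop : ∫⁻ τ in Set.Ioc (0:ℝ) 1, ‖φ' τ‖ₑ = ⊤
  · rw [htop]; exact le_top
  have hint : IntervalIntegrable φ' volume 0 1 := by
    rw [intervalIntegrable_iff_integrableOn_Ioc_of_le zero_le_one]
    exact ⟨hm.aestronglyMeasurable, lt_top_iff_ne_top.2 htop⟩
  have hd : ∀ τ ∈ Set.uIcc (0:ℝ) 1, HasDerivAt (fun τ : ℝ => f (x + τ • (y - x))) (φ' τ) τ := by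
    intro τ hτ
    rw [Set.uIcc_of_le zero_le_one] at hτ
    have hmem : x + τ • (y - x) ∈ Ω := hc.add_smul_sub_mem hx hy hτ
    have h1 := (hf.differentiableAt (ho.mem_nhds hmem)).hasFDerivAt
    have h2 : HasDerivAt (fun τ : ℝ => x + τ • (y - x)) (y - x) τ := by
      simpa using ((hasDerivAt_id τ).smul_const (y - x)).const_add x
    exact h1.comp_hasDerivAt τ h2
  have := intervalIntegral.integral_eq_sub_of_hasDerivAt hd hint
  simp only [one_smul, zero_smul, add_zero, add_sub_cancel] at this
  rw [← this, intervalIntegral.integral_of_le zero_le_one]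
  exact enorm_integral_le_lintegral_enorm _

lemma cov {n : ℕ} (x : EE n) {τ : ℝ} (hτ : 0 < τ) (Ψ : EE n → ℝ≥0∞) (hΨ : Measurable Ψ) :
    ∫⁻ y, Ψ (x + τ • (y - x)) = ENNReal.ofReal (τ ^ (-(n:ℝ))) * ∫⁻ z, Ψ z := by
  have h1 : ∫⁻ y, Ψ (x + τ • (y - x)) = ∫⁻ y, Ψ (x + τ • y) := by
    rw [← lintegral_add_right_eq_self _ x]; simp
  have h2 : ∫⁻ y : EE n, Ψ (x + τ • y) = ∫⁻ y, Ψ (x + y) ∂(Measure.map (fun x => τ • x) volume) := by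
    rw [lintegral_map (by fun_prop) (by fun_prop)]
  rw [h1, h2, Measure.map_addHaar_smul _ hτ.ne', lintegral_smul_measure, lintegral_add_left_eq_self,
    smul_eq_mul]
  congr 2
  rw [finrank_euclideanSpace_fin, abs_of_nonneg (by positivity), Real.rpow_neg hτ.le,
    Real.rpow_natCast]

lemma dist_le_d {n : ℕ} {Ω : Set (EE n)} (hb : Bornology.IsBounded Ω) {x y : EE n} (hx : x ∈ Ω)
    (hy : y ∈ Ω) : ‖x - y‖ ≤ Metric.diam Ω := by
  rw [← dist_eq_norm]; exact Metric.dist_le_diam_of_mem hb hx hy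

lemma tau_int (n : ℕ) (hn : 2 ≤ n) (ρ : ℝ) (hρ : 0 < ρ) :
    ∫⁻ τ in Set.Ioi ρ, ENNReal.ofReal (τ ^ (-(n:ℝ) - 1)) = ENNReal.ofReal (ρ ^ (-(n:ℝ)) / n) := by
  have hn0 : (0:ℝ) < n := by positivity
  rw [← ofReal_integral_eq_lintegral_ofReal
    (integrableOn_Ioi_rpow_of_lt (by linarith) hρ)]
  · rw [integral_Ioi_rpow_of_lt (by linarith) hρ]
    congr 1
    rw [sub_add_cancel]
    field_simp
  · filter_upwards [ae_restrict_mem measurableSet_Ioi] with τ hτ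
    exact Real.rpow_nonneg (hρ.trans hτ).le _

lemma riesz {n : ℕ} (hn : 2 ≤ n) {Ω : Set (EE n)} (ho : IsOpen Ω) (hc : Convex ℝ Ω)
    (hb : Bornology.IsBounded Ω) (hd : 0 < Metric.diam Ω) {G : EE n → ℝ≥0∞} (hG : Measurable G)
    {x : EE n} (hx : x ∈ Ω) :
    ∫⁻ y in Ω, ‖y - x‖ₑ * ∫⁻ τ in Set.Ioc (0:ℝ) 1, G (x + τ • (y - x)) ≤
      ENNReal.ofReal (Metric.diam Ω ^ n / n) * ∫⁻ z in Ω, G z * ‖z - x‖ₑ ^ (-((n:ℝ) - 1)) := by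
  set d := Metric.diam Ω
  set χ : EE n → ℝ≥0∞ := Ω.indicator 1 with hχd
  have hχ : Measurable χ := measurable_one.indicator ho.measurableSet
  have hn0 : (0:ℝ) < n := by positivity
  have ind : ∀ F : EE n → ℝ≥0∞, ∫⁻ y in Ω, F y = ∫⁻ y, χ y * F y := by
    intro F
    rw [← lintegral_indicator ho.measurableSet]
    congr 1; ext y; by_cases h : y ∈ Ω <;> simp [χ, h]
  -- the truncation
  set κ : ℝ × EE n → ℝ≥0∞ :=
    Set.indicator {p : ℝ × EE n | ‖p.2 - x‖ ≤ d * p.1} 1 with hκd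
  have hκ : Measurable κ := by
    refine measurable_one.indicator (measurableSet_le (by fun_prop) (by fun_prop))
  calc ∫⁻ y in Ω, ‖y - x‖ₑ * ∫⁻ τ in Set.Ioc (0:ℝ) 1, G (x + τ • (y - x))
      = ∫⁻ y, ∫⁻ τ in Set.Ioc (0:ℝ) 1, χ y * ‖y - x‖ₑ * G (x + τ • (y - x)) := by
        rw [ind]
        refine lintegral_congr fun y => ?_
        rw [lintegral_const_mul _ (by fun_prop), mul_assoc]
    _ = ∫⁻ τ in Set.Ioc (0:ℝ) 1, ∫⁻ y, χ y * ‖y - x‖ₑ * G (x + τ • (y - x)) := by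
        rw [lintegral_lintegral_swap]
        refine Measurable.aemeasurable ?_
        unfold Function.uncurry
        fun_prop
    _ ≤ ∫⁻ τ in Set.Ioc (0:ℝ) 1, ∫⁻ z, χ z * G z * ‖z - x‖ₑ *
          (κ (τ, z) * ENNReal.ofReal (τ ^ (-(n:ℝ) - 1))) := by
        refine setLIntegral_mono' measurableSet_Ioc fun τ hτ => ?_
        have hτ0 := hτ.1
        set Ψ : EE n → ℝ≥0∞ := fun z => χ (x + τ⁻¹ • (z - x)) * ‖τ⁻¹ • (z - x)‖ₑ * G z
        have hΨ : Measurable Ψ := by fun_prop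
        have e1 : ∀ y, χ y * ‖y - x‖ₑ * G (x + τ • (y - x)) = Ψ (x + τ • (y - x)) := by
          intro y
          simp only [Ψ, add_sub_cancel_left, smul_smul, inv_mul_cancel₀ hτ0.ne', one_smul,
            add_sub_cancel]
        simp_rw [e1]
        rw [cov x hτ0 Ψ hΨ, ← lintegral_const_mul _ hΨ]
        refine lintegral_mono fun z => ?_
        simp only [Ψ]
        by_cases hz : x + τ⁻¹ • (z - x) ∈ Ω
        · have hzΩ : z ∈ Ω := by
            have := hc.add_smul_sub_mem hx hz ⟨hτ0.le, hτ.2⟩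
            simpa [smul_smul, hτ0.ne'] using this
          have hk : ‖z - x‖ ≤ d * τ := by
            have := dist_le_d hb hz hx
            rw [add_sub_cancel_left, norm_smul, norm_inv, Real.norm_eq_abs, abs_of_pos hτ0,
              inv_mul_le_iff₀ hτ0] at this
            linarith
          have hκ1 : κ (τ, z) = 1 := by simp [κ, hk]
          have hχ1 : χ z = 1 := by simp [χ, hzΩ]
          have hχ2 : χ (x + τ⁻¹ • (z - x)) = 1 := by simp [χ, hz]
          rw [hκ1, hχ1, hχ2, one_mul, one_mul, one_mul, Real.rpow_sub hτ0, Real.rpow_one,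
            ENNReal.ofReal_div_of_pos hτ0, enorm_smul, enorm_inv hτ0.ne',
            Real.enorm_of_nonneg hτ0.le, ENNReal.div_eq_inv_mul]
          apply le_of_eq; ring
        · have hχ2 : χ (x + τ⁻¹ • (z - x)) = 0 := by simp [χ, hz]
          simp [hχ2]
    _ = ∫⁻ z, ∫⁻ τ in Set.Ioc (0:ℝ) 1, χ z * G z * ‖z - x‖ₑ *
          (κ (τ, z) * ENNReal.ofReal (τ ^ (-(n:ℝ) - 1))) := by
        rw [lintegral_lintegral_swap]
        refine Measurable.aemeasurable ?_
        unfold Function.uncurry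
        fun_prop
    _ ≤ ∫⁻ z, χ z * (ENNReal.ofReal (d ^ n / n) * (G z * ‖z - x‖ₑ ^ (-((n:ℝ) - 1)))) := by
        refine lintegral_mono fun z => ?_
        dsimp only
        rw [lintegral_const_mul _ (by fun_prop)]
        by_cases hz : z = x
        · simp [hz]
        have hz0 : 0 < ‖z - x‖ := norm_pos_iff.2 (sub_ne_zero.2 hz)
        have h1 : ∫⁻ τ in Set.Ioc (0:ℝ) 1, κ (τ, z) * ENNReal.ofReal (τ ^ (-(n:ℝ) - 1)) ≤
            ENNReal.ofReal ((‖z - x‖ / d) ^ (-(n:ℝ)) / n) := by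
          rw [← tau_int n hn _ (by positivity), ← lintegral_indicator measurableSet_Ioc,
            setLIntegral_congr Ioi_ae_eq_Ici, ← lintegral_indicator measurableSet_Ici]
          refine lintegral_mono fun τ => ?_
          by_cases hτ : τ ∈ Set.Ici (‖z - x‖ / d)
          · rw [Set.indicator_of_mem hτ]
            by_cases hτ' : τ ∈ Set.Ioc (0:ℝ) 1
            · rw [Set.indicator_of_mem hτ']
              by_cases hh : ‖z - x‖ ≤ d * τ <;> simp [κ, hh]
            · simp [hτ']
          · have : ¬ ‖z - x‖ ≤ d * τ := by
              intro h; apply hτ; rw [Set.mem_Ici, div_le_iff₀ hd]; linarith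
            simp [κ, this, Set.indicator]
        have h2 : ‖z - x‖ₑ * ENNReal.ofReal ((‖z - x‖ / d) ^ (-(n:ℝ)) / n) =
            ENNReal.ofReal (d ^ n / n) * ‖z - x‖ₑ ^ (-((n:ℝ) - 1)) := by
          rw [← ofReal_norm, ENNReal.ofReal_rpow_of_pos hz0, ← ENNReal.ofReal_mul (by positivity),
            ← ENNReal.ofReal_mul (by positivity)]
          congr 1
          rw [Real.div_rpow hz0.le hd.le, Real.rpow_neg hd.le, neg_sub, sub_eq_add_neg (1:ℝ),
            Real.rpow_add hz0, Real.rpow_one, Real.rpow_natCast]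
          field_simp
        calc χ z * G z * ‖z - x‖ₑ * ∫⁻ τ in Set.Ioc (0:ℝ) 1, κ (τ, z) * ENNReal.ofReal (τ ^ (-(n:ℝ) - 1))
            ≤ χ z * G z * ‖z - x‖ₑ * ENNReal.ofReal ((‖z - x‖ / d) ^ (-(n:ℝ)) / n) := by gcongr
          _ = χ z * G z * (‖z - x‖ₑ * ENNReal.ofReal ((‖z - x‖ / d) ^ (-(n:ℝ)) / n)) := by ring
          _ = _ := by rw [h2]; ring
    _ = _ := by
        rw [← ind, lintegral_const_mul _ (by fun_prop)]

lemma Wlem {n : ℕ} (hn : 2 ≤ n) {Ω : Set (EE n)} (ho : IsOpen Ω) (hc : Convex ℝ Ω)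
    (hb : Bornology.IsBounded Ω) (hd : 0 < Metric.diam Ω) {G : EE n → ℝ≥0∞} (hG : Measurable G) :
    ∫⁻ x in Ω, ∫⁻ y in Ω, ‖y - x‖ₑ * ∫⁻ τ in Set.Ioc (0:ℝ) 1, G (x + τ • (y - x)) ≤
      ENNReal.ofReal (unitBallVolume n * Metric.diam Ω ^ (n + 1) / (n + 1)) * ∫⁻ z in Ω, G z := by
  set d := Metric.diam Ω
  set χ : EE n → ℝ≥0∞ := Ω.indicator 1 with hχd
  have hχ : Measurable χ := measurable_one.indicator ho.measurableSet
  have ind : ∀ F : EE n → ℝ≥0∞, ∫⁻ y in Ω, F y = ∫⁻ y, χ y * F y := by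
    intro F
    rw [← lintegral_indicator ho.measurableSet]
    congr 1; ext y; by_cases h : y ∈ Ω <;> simp [χ, h]
  calc ∫⁻ x in Ω, ∫⁻ y in Ω, ‖y - x‖ₑ * ∫⁻ τ in Set.Ioc (0:ℝ) 1, G (x + τ • (y - x))
      = ∫⁻ x, ∫⁻ h, ∫⁻ τ in Set.Ioc (0:ℝ) 1, χ x * χ (x + h) * ‖h‖ₑ * G (x + τ • h) := by
        rw [ind]
        refine lintegral_congr fun x => ?_
        rw [ind, ← lintegral_const_mul _ (by fun_prop), ← lintegral_add_left_eq_self _ x]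
        refine lintegral_congr fun h => ?_
        rw [lintegral_const_mul _ (by fun_prop)]
        simp only [add_sub_cancel_left]
        ring
    _ = ∫⁻ h, ∫⁻ x, ∫⁻ τ in Set.Ioc (0:ℝ) 1, χ x * χ (x + h) * ‖h‖ₑ * G (x + τ • h) := by
        rw [lintegral_lintegral_swap]
        refine Measurable.aemeasurable ?_
        unfold Function.uncurry
        refine Measurable.lintegral_prod_right ?_
        unfold Function.uncurry
        fun_prop
    _ = ∫⁻ h, ∫⁻ τ in Set.Ioc (0:ℝ) 1, ∫⁻ x, χ x * χ (x + h) * ‖h‖ₑ * G (x + τ • h) := by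
        refine lintegral_congr fun h => ?_
        rw [lintegral_lintegral_swap]
        refine Measurable.aemeasurable ?_
        unfold Function.uncurry
        fun_prop
    _ ≤ ∫⁻ h, ∫⁻ τ in Set.Ioc (0:ℝ) 1, ∫⁻ z, χ z * G z *
          (‖h‖ₑ * (χ (z - τ • h) * χ (z + (1 - τ) • h))) := by
        refine lintegral_mono fun h => ?_
        refine setLIntegral_mono' measurableSet_Ioc fun τ hτ => ?_
        rw [← lintegral_sub_right_eq_self _ (τ • h)]
        refine lintegral_mono fun z => ?_
        dsimp only
        have e1 : z - τ • h + h = z + (1 - τ) • h := by rw [sub_smul, one_smul]; abel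
        rw [e1, sub_add_cancel]
        by_cases h1 : z - τ • h ∈ Ω
        · by_cases h2 : z + (1 - τ) • h ∈ Ω
          · have hz : z ∈ Ω := by
              have := hc.add_smul_sub_mem h1 h2 ⟨hτ.1.le, hτ.2⟩
              have e : z - τ • h + τ • (z + (1 - τ) • h - (z - τ • h)) = z := by module
              rwa [e] at this
            have : χ z = 1 := by simp [χ, hz]
            rw [this]; apply le_of_eq; ring
          · simp [χ, h2]
        · simp [χ, h1]
    _ = ∫⁻ h, ∫⁻ z, ∫⁻ τ in Set.Ioc (0:ℝ) 1, χ z * G z *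
          (‖h‖ₑ * (χ (z - τ • h) * χ (z + (1 - τ) • h))) := by
        refine lintegral_congr fun h => ?_
        rw [lintegral_lintegral_swap]
        refine Measurable.aemeasurable ?_
        unfold Function.uncurry
        fun_prop
    _ = ∫⁻ z, ∫⁻ h, ∫⁻ τ in Set.Ioc (0:ℝ) 1, χ z * G z *
          (‖h‖ₑ * (χ (z - τ • h) * χ (z + (1 - τ) • h))) := by
        rw [lintegral_lintegral_swap]
        refine Measurable.aemeasurable ?_
        unfold Function.uncurry
        refine Measurable.lintegral_prod_right ?_
        unfold Function.uncurry
        fun_prop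
    _ ≤ ∫⁻ z, ∫⁻ h : EE n, χ z * G z * ENNReal.ofReal (d - ‖h‖) := by
        refine lintegral_mono fun z => lintegral_mono fun h => ?_
        dsimp only
        rw [lintegral_const_mul _ (by fun_prop), lintegral_const_mul _ (by fun_prop)]
        gcongr
        by_cases hh : h = 0
        · simp [hh]
        have hh0 : 0 < ‖h‖ := norm_pos_iff.2 hh
        set T : Set ℝ := {τ | z - τ • h ∈ Ω ∧ z + (1 - τ) • h ∈ Ω} with hT
        have hTm : MeasurableSet T := by
          apply IsOpen.measurableSet
          exact (ho.preimage (by fun_prop : Continuous fun τ : ℝ => z - τ • h)).inter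
            (ho.preimage (by fun_prop : Continuous fun τ : ℝ => z + (1 - τ) • h))
        have e1 : ∀ τ, χ (z - τ • h) * χ (z + (1 - τ) • h) = T.indicator 1 τ := by
          intro τ
          by_cases h1 : z - τ • h ∈ Ω <;> by_cases h2 : z + (1 - τ) • h ∈ Ω <;>
            simp [χ, T, h1, h2]
        simp_rw [e1]
        rw [lintegral_indicator_one hTm]
        have key : ∀ a ∈ T, ∀ b ∈ T, (1 + (b - a)) * ‖h‖ ≤ d := by
          intro a ha b hb'
          have := dist_le_d hb ha.2 hb'.1
          have e : z + (1 - a) • h - (z - b • h) = (1 + (b - a)) • h := by module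
          rw [e, norm_smul] at this
          exact (mul_le_mul_of_nonneg_right (le_abs_self _) hh0.le).trans this
        have hvol : volume T ≤ ENNReal.ofReal ((d - ‖h‖) / ‖h‖) := by
          refine (Real.volume_le_diam T).trans (Metric.ediam_le fun a ha b hb' => ?_)
          rw [edist_dist, Real.dist_eq]
          apply ENNReal.ofReal_le_ofReal
          rw [le_div_iff₀ hh0]
          have k1 := key a ha b hb'
          have k2 := key b hb' a ha
          rcases abs_cases (a - b) with ⟨h1, -⟩ | ⟨h1, -⟩ <;> rw [h1] <;> linarith
        calc ‖h‖ₑ * (volume.restrict (Set.Ioc 0 1)) T ≤ ‖h‖ₑ * ENNReal.ofReal ((d - ‖h‖) / ‖h‖) := by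
              gcongr
              exact (Measure.restrict_apply_le _ _).trans hvol
          _ = _ := by
              rw [← ofReal_norm, ← ENNReal.ofReal_mul hh0.le]
              congr 1; field_simp
    _ = (∫⁻ z, χ z * G z) * ∫⁻ h : EE n, ENNReal.ofReal (d - ‖h‖) := by
        rw [← lintegral_mul_const _ (by fun_prop)]
        refine lintegral_congr fun z => ?_
        rw [lintegral_const_mul _ (by fun_prop)]
    _ = _ := by
        rw [← ind, mul_comm, ← ball_W n hn d hd, ← lintegral_indicator measurableSet_ball]
        congr 2; ext h
        by_cases hh : ‖h‖ < d
        · simp [hh]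
        · simp [hh, ENNReal.ofReal_of_nonpos (by linarith : d - ‖h‖ ≤ 0)]

lemma lens {n : ℕ} (hn : 2 ≤ n) {Ω : Set (EE n)} (hne : Ω.Nonempty)
    (hb : Bornology.IsBounded Ω) :
    volume Ω ≤ ENNReal.ofReal (unitBallVolume n * (√3 / 2 * Metric.diam Ω) ^ n) := by
  haveI : Nonempty (Fin n) := ⟨⟨0, by omega⟩⟩
  have hK : IsCompact (closure Ω) := hb.isCompact_closure
  have hKK : IsCompact (closure Ω ×ˢ closure Ω) := hK.prod hK
  have hKne : (closure Ω ×ˢ closure Ω).Nonempty := hne.closure.prod hne.closure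
  obtain ⟨⟨a, b⟩, ⟨ha, hb'⟩, hmax⟩ := hKK.exists_isMaxOn hKne
    (f := fun p : EE n × EE n => dist p.1 p.2) (by fun_prop)
  have hmax' := isMaxOn_iff.1 hmax
  have hdd : Metric.diam Ω ≤ dist a b := by
    rw [← Metric.diam_closure]
    refine Metric.diam_le_of_forall_dist_le dist_nonneg fun x hx y hy => ?_
    exact hmax' (x, y) (Set.mk_mem_prod hx hy)
  have hsub : Ω ⊆ closedBall ((1/2:ℝ) • (a + b)) (√3 / 2 * Metric.diam Ω) := by
    intro z hz
    have hz' := subset_closure hz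
    have hbc : Bornology.IsBounded (closure Ω) := hb.closure
    have d1 : dist z a ≤ Metric.diam Ω := by
      rw [← Metric.diam_closure]; exact Metric.dist_le_diam_of_mem hbc hz' ha
    have d2 : dist z b ≤ Metric.diam Ω := by
      rw [← Metric.diam_closure]; exact Metric.dist_le_diam_of_mem hbc hz' hb'
    rw [mem_closedBall, dist_eq_norm]
    rw [dist_eq_norm] at d1 d2 hdd
    have hd0 : 0 ≤ Metric.diam Ω := Metric.diam_nonneg
    have par := parallelogram_law_with_norm ℝ (z - a) (z - b)
    have e1 : z - a + (z - b) = (2:ℝ) • (z - (1/2:ℝ) • (a + b)) := by module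
    have e2 : z - a - (z - b) = -(a - b) := by abel
    rw [e1, e2, norm_smul, norm_neg] at par
    norm_num at par
    refine abs_le_of_sq_le_sq' ?_ (by positivity) |>.2
    rw [mul_pow, div_pow, Real.sq_sqrt (by norm_num)]
    norm_num
    have q1 : ‖z - a‖ * ‖z - a‖ ≤ Metric.diam Ω * Metric.diam Ω := by gcongr
    have q2 : ‖z - b‖ * ‖z - b‖ ≤ Metric.diam Ω * Metric.diam Ω := by gcongr
    have q3 : Metric.diam Ω * Metric.diam Ω ≤ ‖a - b‖ * ‖a - b‖ := by gcongr
    nlinarith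
  refine (measure_mono hsub).trans ?_
  rw [Measure.addHaar_closedBall_eq_addHaar_ball, vol_ball n hn _ _ (by positivity)]

lemma young {α : Type*} [MeasurableSpace α] (μ : Measure α) [SFinite μ] (K : α → α → ℝ≥0∞)
    (hK : Measurable (Function.uncurry K)) (G : α → ℝ≥0∞) (hG : Measurable G) (a b c : ℝ)
    (ha : 0 < a) (hb : 0 ≤ b) (hc : 0 ≤ c) (habc : a + b + c = 1) (H : ℝ≥0∞)
    (h1 : ∀ x, ∫⁻ z, K x z ∂μ ≤ H) (h2 : ∀ z, ∫⁻ x, K x z ∂μ ≤ H) :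
    (∫⁻ x, (∫⁻ z, K x z ^ (a + b) * G z ^ (a + c) ∂μ) ^ (1 / a) ∂μ) ^ a ≤
      H ^ (a + b) * (∫⁻ z, G z ∂μ) ^ (a + c) := by
  have hKx : ∀ x, Measurable (K x) := fun x => hK.comp measurable_prodMk_left
  have hKz : ∀ z, Measurable (fun x => K x z) := fun z => hK.comp measurable_prodMk_right
  set I := ∫⁻ z, G z ∂μ
  have step : ∀ x, ∫⁻ z, K x z ^ (a + b) * G z ^ (a + c) ∂μ ≤
      (∫⁻ z, K x z * G z ∂μ) ^ a * (H ^ b * I ^ c) := by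
    intro x
    have hh := ENNReal.lintegral_prod_norm_pow_le (μ := μ) (Finset.univ : Finset (Fin 3))
      (f := ![fun z => K x z * G z, fun z => K x z, G])
      (by
        have := hKx x
        intro i _; fin_cases i
        · exact ((hKx x).mul hG).aemeasurable
        · exact (hKx x).aemeasurable
        · exact hG.aemeasurable)
      (p := ![a, b, c])
      (by simp [Fin.sum_univ_three, habc])
      (by intro i _; fin_cases i <;> simp [ha.le, hb, hc])
    simp only [Fin.prod_univ_three] at hh
    simp only [Matrix.cons_val_zero, Matrix.cons_val_one, Matrix.cons_val] at hh
    calc ∫⁻ z, K x z ^ (a + b) * G z ^ (a + c) ∂μ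
        = ∫⁻ z, (K x z * G z) ^ a * K x z ^ b * G z ^ c ∂μ := by
          refine lintegral_congr fun z => ?_
          rw [ENNReal.rpow_add_of_nonneg _ _ ha.le hb, ENNReal.rpow_add_of_nonneg _ _ ha.le hc,
            ENNReal.mul_rpow_of_nonneg _ _ ha.le]
          ring
      _ ≤ _ := hh
      _ ≤ (∫⁻ z, K x z * G z ∂μ) ^ a * (H ^ b * I ^ c) := by
          rw [mul_assoc]
          gcongr
          exact h1 x
  have ha' : 0 ≤ 1 / a := by positivity
  have hKG : Measurable (fun x => ∫⁻ z, K x z * G z ∂μ) := by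
    refine Measurable.lintegral_prod_right ?_
    exact hK.mul (hG.comp measurable_snd)
  calc (∫⁻ x, (∫⁻ z, K x z ^ (a + b) * G z ^ (a + c) ∂μ) ^ (1 / a) ∂μ) ^ a
      ≤ (∫⁻ x, ((∫⁻ z, K x z * G z ∂μ) ^ a * (H ^ b * I ^ c)) ^ (1 / a) ∂μ) ^ a := by
        gcongr with x
        exact step x
    _ = (∫⁻ x, (∫⁻ z, K x z * G z ∂μ) * (H ^ b * I ^ c) ^ (1 / a) ∂μ) ^ a := by
        congr 1
        refine lintegral_congr fun x => ?_
        rw [ENNReal.mul_rpow_of_nonneg _ _ ha', ← ENNReal.rpow_mul, mul_one_div_cancel ha.ne',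
          ENNReal.rpow_one]
    _ = (∫⁻ x, (∫⁻ z, K x z * G z ∂μ) ∂μ) ^ a * (H ^ b * I ^ c) := by
        rw [lintegral_mul_const _ hKG, ENNReal.mul_rpow_of_nonneg _ _ ha.le, ← ENNReal.rpow_mul,
          one_div_mul_cancel ha.ne', ENNReal.rpow_one]
    _ ≤ (H * I) ^ a * (H ^ b * I ^ c) := by
        gcongr
        rw [lintegral_lintegral_swap (hK.mul (hG.comp measurable_snd)).aemeasurable,
          ← lintegral_const_mul _ hG]
        refine lintegral_mono fun z => ?_
        dsimp only
        rw [lintegral_mul_const _ (hKz z)]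
        gcongr
        exact h2 z
    _ = _ := by
        rw [ENNReal.rpow_add_of_nonneg _ _ ha.le hb, ENNReal.rpow_add_of_nonneg _ _ ha.le hc,
          ENNReal.mul_rpow_of_nonneg _ _ ha.le]
        ring

lemma jensen {g : ℝ → ℝ≥0∞} (hg : Measurable g) {q : ℝ} (hq : 1 ≤ q) :
    (∫⁻ τ in Set.Ioc (0:ℝ) 1, g τ) ^ q ≤ ∫⁻ τ in Set.Ioc (0:ℝ) 1, g τ ^ q := by
  have h := eLpNorm'_le_eLpNorm'_mul_rpow_measure_univ (μ := volume.restrict (Set.Ioc (0:ℝ) 1))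
    zero_lt_one hq (f := g) hg.aestronglyMeasurable
  simp only [eLpNorm', enorm_eq_self, ENNReal.rpow_one, div_one] at h
  have hq0 : 0 < q := by linarith
  have hv : (volume.restrict (Set.Ioc (0:ℝ) 1)) Set.univ = 1 := by simp
  rw [hv, ENNReal.one_rpow, mul_one] at h
  calc _ ≤ ((∫⁻ τ in Set.Ioc (0:ℝ) 1, g τ ^ q) ^ (1 / q)) ^ q := by gcongr
    _ = _ := by rw [← ENNReal.rpow_mul, one_div_mul_cancel hq0.ne', ENNReal.rpow_one]

lemma enorm_conv (a r : ℝ) (hr : 0 ≤ r) : ENNReal.ofReal (|a| ^ r) = ‖a‖ₑ ^ r := by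
  rw [← ENNReal.ofReal_rpow_of_nonneg (abs_nonneg a) hr, ← Real.norm_eq_abs, ofReal_norm]

lemma meas_g {n : ℕ} (f : EE n → ℝ) : Measurable (fun x => ‖fderiv ℝ f x‖ₑ) :=
  (measurable_fderiv ℝ f).enorm

lemma low {n : ℕ} {Ω : Set (EE n)} (ho : IsOpen Ω) (hc : Convex ℝ Ω)
    (hne : Ω.Nonempty) (hb : Bornology.IsBounded Ω) {f : EE n → ℝ}
    (hf : DifferentiableOn ℝ f Ω) {r q : ℝ} (hr : 1 ≤ r) (hrq : r ≤ q) (M : ℝ≥0∞)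
    (hM : ∀ G : EE n → ℝ≥0∞, Measurable G →
      ∫⁻ x in Ω, ∫⁻ y in Ω, ‖y - x‖ₑ * ∫⁻ τ in Set.Ioc (0:ℝ) 1, G (x + τ • (y - x)) ≤
        M * ∫⁻ z in Ω, G z) :
    (⨅ c : ℝ, (∫⁻ x in Ω, ‖f x - c‖ₑ ^ r) ^ (1 / r)) ≤
      volume Ω ^ (1 / r - 1 / q) * (ENNReal.ofReal (Metric.diam Ω ^ (q - 1)) * M / volume Ω) ^ (1 / q)
        * (∫⁻ x in Ω, ‖fderiv ℝ f x‖ₑ ^ q) ^ (1 / q) := by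
  set J := ⨅ c : ℝ, (∫⁻ x in Ω, ‖f x - c‖ₑ ^ r) ^ (1 / r)
  set d := Metric.diam Ω
  have hq0 : 0 < q := by linarith
  have hr0 : 0 < r := by linarith
  set v := volume Ω
  have hv0 : v ≠ 0 := (ho.measure_pos volume hne).ne'
  have hvt : v ≠ ⊤ := hb.measure_lt_top.ne
  have hg := meas_g f
  have hfm : AEStronglyMeasurable f (volume.restrict Ω) :=
    hf.continuousOn.aestronglyMeasurable ho.measurableSet
  have pt : ∀ x ∈ Ω, ∀ y ∈ Ω, ‖f y - f x‖ₑ ^ q ≤ ENNReal.ofReal (d ^ (q - 1)) *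
      (‖y - x‖ₑ * ∫⁻ τ in Set.Ioc (0:ℝ) 1, ‖fderiv ℝ f (x + τ • (y - x))‖ₑ ^ q) := by
    intro x hx y hy
    calc ‖f y - f x‖ₑ ^ q ≤ (‖y - x‖ₑ * ∫⁻ τ in Set.Ioc (0:ℝ) 1,
          ‖fderiv ℝ f (x + τ • (y - x))‖ₑ) ^ q := by
          gcongr; exact ftc ho hc hf hx hy
      _ = ‖y - x‖ₑ ^ (q - 1) * ‖y - x‖ₑ * (∫⁻ τ in Set.Ioc (0:ℝ) 1,
          ‖fderiv ℝ f (x + τ • (y - x))‖ₑ) ^ q := by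
          rw [ENNReal.mul_rpow_of_nonneg _ _ hq0.le]
          congr 1
          nth_rewrite 3 [← ENNReal.rpow_one ‖y - x‖ₑ]
          rw [← ENNReal.rpow_add_of_nonneg _ _ (by linarith) zero_le_one]
          simp
      _ ≤ ENNReal.ofReal (d ^ (q - 1)) * ‖y - x‖ₑ * ∫⁻ τ in Set.Ioc (0:ℝ) 1,
          ‖fderiv ℝ f (x + τ • (y - x))‖ₑ ^ q := by
          gcongr
          · rw [← ENNReal.ofReal_rpow_of_nonneg Metric.diam_nonneg (by linarith), ← ofReal_norm]
            exact ENNReal.rpow_le_rpow (ENNReal.ofReal_le_ofReal (dist_le_d hb hy hx)) (by linarith)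
          · exact jensen (hg.comp (by fun_prop)) (by linarith)
      _ = _ := by ring
  have hJ : ∀ c : ℝ, J ^ q ≤ (v ^ (1 / r - 1 / q)) ^ q * ∫⁻ x in Ω, ‖f x - c‖ₑ ^ q := by
    intro c
    have h := eLpNorm'_le_eLpNorm'_mul_rpow_measure_univ (μ := volume.restrict Ω)
      hr0 hrq (f := fun x => f x - c) (hfm.sub aestronglyMeasurable_const)
    simp only [eLpNorm', Measure.restrict_apply_univ] at h
    have h' : J ≤ _ := (iInf_le _ c).trans h
    calc J ^ q ≤ _ := ENNReal.rpow_le_rpow h' hq0.le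
      _ = _ := by
        rw [ENNReal.mul_rpow_of_nonneg _ _ hq0.le, ← ENNReal.rpow_mul _ (1/q) q,
          one_div_mul_cancel hq0.ne', ENNReal.rpow_one, mul_comm]
  have main : J ^ q * v ≤ (v ^ (1 / r - 1 / q)) ^ q * (ENNReal.ofReal (d ^ (q - 1)) *
      (M * ∫⁻ x in Ω, ‖fderiv ℝ f x‖ₑ ^ q)) := by
    have hfin : (v ^ (1 / r - 1 / q)) ^ q ≠ ⊤ := by
      apply ENNReal.rpow_ne_top_of_nonneg hq0.le
      apply ENNReal.rpow_ne_top_of_nonneg _ hvt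
      rw [sub_nonneg]; exact one_div_le_one_div_of_le hr0 hrq
    calc J ^ q * v = ∫⁻ x in Ω, J ^ q := by rw [setLIntegral_const]
      _ ≤ ∫⁻ x in Ω, (v ^ (1 / r - 1 / q)) ^ q * ∫⁻ y in Ω, ‖f y - f x‖ₑ ^ q :=
          lintegral_mono fun x => hJ (f x)
      _ = (v ^ (1 / r - 1 / q)) ^ q * ∫⁻ x in Ω, ∫⁻ y in Ω, ‖f y - f x‖ₑ ^ q :=
          lintegral_const_mul' _ _ hfin
      _ ≤ _ := by
          gcongr
          calc ∫⁻ x in Ω, ∫⁻ y in Ω, ‖f y - f x‖ₑ ^ q ≤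
              ∫⁻ x in Ω, ENNReal.ofReal (d ^ (q - 1)) * ∫⁻ y in Ω,
                (‖y - x‖ₑ * ∫⁻ τ in Set.Ioc (0:ℝ) 1, ‖fderiv ℝ f (x + τ • (y - x))‖ₑ ^ q) := by
                refine setLIntegral_mono' ho.measurableSet fun x hx => ?_
                rw [← lintegral_const_mul' _ _ ENNReal.ofReal_ne_top]
                exact setLIntegral_mono' ho.measurableSet fun y hy => pt x hx y hy
            _ ≤ _ := by
                rw [lintegral_const_mul' _ _ ENNReal.ofReal_ne_top]
                gcongr
                exact hM _ (hg.pow_const q)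
  have main2 : J ^ q ≤ (v ^ (1 / r - 1 / q)) ^ q * ((ENNReal.ofReal (d ^ (q - 1)) * M / v) *
      ∫⁻ x in Ω, ‖fderiv ℝ f x‖ₑ ^ q) := by
    rw [← ENNReal.le_div_iff_mul_le (Or.inl hv0) (Or.inl hvt)] at main
    refine main.trans (le_of_eq ?_)
    simp only [div_eq_mul_inv]
    ring
  calc J = (J ^ q) ^ (1 / q) := by
        rw [← ENNReal.rpow_mul, mul_one_div_cancel hq0.ne', ENNReal.rpow_one]
    _ ≤ _ := ENNReal.rpow_le_rpow main2 (by positivity)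
    _ = _ := by
        rw [ENNReal.mul_rpow_of_nonneg _ _ (by positivity),
          ENNReal.mul_rpow_of_nonneg _ _ (by positivity), ← ENNReal.rpow_mul _ q (1 / q),
          mul_one_div_cancel hq0.ne', ENNReal.rpow_one, mul_assoc]

lemma high {n : ℕ} (hn : 2 ≤ n) {Ω : Set (EE n)} (ho : IsOpen Ω) (hc : Convex ℝ Ω)
    (hne : Ω.Nonempty) (hb : Bornology.IsBounded Ω) (hd : 0 < Metric.diam Ω) {f : EE n → ℝ}
    (hf : DifferentiableOn ℝ f Ω) {r q : ℝ} (hq : 1 ≤ q) (hqr : q ≤ r)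
    (hadm : 0 < 1 / (n : ℝ) - 1 / q + 1 / r) (R : ℝ) (hR : 0 < R)
    (hV : volume Ω = ENNReal.ofReal (unitBallVolume n * R ^ n))
    (hfq : ∫⁻ x in Ω, ‖fderiv ℝ f x‖ₑ ^ q < ⊤) (α : ℝ) (hα : α * (1 - 1 / q + 1 / r) = n - 1) :
    (⨅ c : ℝ, (∫⁻ x in Ω, ‖f x - c‖ₑ ^ r) ^ (1 / r)) ≤
      (volume Ω)⁻¹ * ENNReal.ofReal (Metric.diam Ω ^ n / n) *
      ENNReal.ofReal (n / (n - α) * unitBallVolume n * R ^ ((n:ℝ) - α)) ^ (1 - 1 / q + 1 / r)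
        * (∫⁻ x in Ω, ‖fderiv ℝ f x‖ₑ ^ q) ^ (1 / q) := by
  set d := Metric.diam Ω
  have hq0 : 0 < q := by linarith
  have hr0 : 0 < r := by linarith
  have hn0 : (0:ℝ) < n := by positivity
  have hn1 : (2:ℝ) ≤ n := by exact_mod_cast hn
  have h1q : 1 / q ≤ 1 := by rw [div_le_one hq0]; exact hq
  have hrq : 1 / r ≤ 1 / q := one_div_le_one_div_of_le hq0 hqr
  have h1r : 0 < 1 / r := by positivity
  have hθ : 0 < 1 - 1 / q + 1 / r := by linarith
  have hα0 : 0 ≤ α := by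
    by_contra h
    push Not at h
    have := mul_neg_of_neg_of_pos h hθ
    linarith
  have hαn : α < n := by
    rw [← mul_lt_mul_iff_left₀ hθ, hα]
    have : (n:ℝ) * (1 / n - 1 / q + 1 / r) = n * (1 - 1 / q + 1 / r) - (n - 1) := by
      field_simp; ring
    have h2 := mul_pos hn0 hadm
    linarith
  set v := volume Ω with hvdef
  have hv0 : v ≠ 0 := (ho.measure_pos volume hne).ne'
  have hvt : v ≠ ⊤ := hb.measure_lt_top.ne
  set g : EE n → ℝ≥0∞ := fun x => ‖fderiv ℝ f x‖ₑ with hgdef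
  have hg : Measurable g := meas_g f
  have hfm : AEStronglyMeasurable f (volume.restrict Ω) :=
    hf.continuousOn.aestronglyMeasurable ho.measurableSet
  set k : EE n → EE n → ℝ≥0∞ := fun x z => ‖z - x‖ₑ ^ (-((n:ℝ) - 1)) with hk
  set P : EE n → ℝ≥0∞ := fun x => ∫⁻ z in Ω, g z * k x z with hP
  have hgk : Measurable (Function.uncurry fun x z => g z * k x z) := by
    unfold Function.uncurry; simp only [k]; fun_prop
  have hPm : Measurable P := Measurable.lintegral_prod_right hgk
  set D : ℝ≥0∞ := ENNReal.ofReal (d ^ n / n)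
  have pt : ∀ x ∈ Ω, ∫⁻ y in Ω, ‖f y - f x‖ₑ ≤ D * P x := by
    intro x hx
    refine le_trans ?_ (riesz hn ho hc hb hd hg hx)
    exact setLIntegral_mono' ho.measurableSet fun y hy => ftc ho hc hf hx hy
  -- L1 finiteness
  have hg1 : ∫⁻ x in Ω, g x < ⊤ := by
    have h := eLpNorm'_le_eLpNorm'_mul_rpow_measure_univ (μ := volume.restrict Ω)
      zero_lt_one hq (f := g) hg.aestronglyMeasurable
    simp only [eLpNorm', enorm_eq_self, ENNReal.rpow_one, div_one, Measure.restrict_apply_univ] at h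
    refine h.trans_lt (ENNReal.mul_lt_top ?_ ?_)
    · exact ENNReal.rpow_lt_top_of_nonneg (by positivity) hfq.ne
    · exact ENNReal.rpow_lt_top_of_nonneg (by linarith) hvt
  have hPfin : ∫⁻ x in Ω, P x < ⊤ := by
    have e1 : ∫⁻ x in Ω, P x = ∫⁻ z in Ω, g z * ∫⁻ x in Ω, k x z := by
      simp only [hP]
      rw [lintegral_lintegral_swap hgk.aemeasurable]
      refine lintegral_congr fun z => ?_
      rw [lintegral_const_mul _ (by simp only [k]; fun_prop)]
    rw [e1]
    refine lt_of_le_of_lt (b := (∫⁻ z in Ω, g z) *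
      ENNReal.ofReal (n / (n - ((n:ℝ) - 1)) * unitBallVolume n * R ^ ((n:ℝ) - ((n:ℝ) - 1)))) ?_
      (ENNReal.mul_lt_top hg1 ENNReal.ofReal_lt_top)
    rw [← lintegral_mul_const _ hg]
    refine lintegral_mono fun z => ?_
    dsimp only
    gcongr
    have := rearr n hn Ω ho.measurableSet R ((n:ℝ) - 1) hR hV (by linarith) (by linarith) z
    refine le_trans (le_of_eq ?_) this
    refine lintegral_congr fun x => ?_
    simp only [k]; rw [← enorm_neg, neg_sub]
  obtain ⟨x0, hx0, hx0P⟩ : ∃ x0 ∈ Ω, P x0 < ⊤ := by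
    have hae := ae_lt_top hPm hPfin.ne
    by_contra hcon
    push Not at hcon
    have : ∀ᵐ x ∂(volume.restrict Ω), False := by
      filter_upwards [hae, ae_restrict_mem ho.measurableSet] with x h1 h2
      exact absurd h1 (not_lt.2 (hcon x h2))
    rw [Filter.eventually_false_iff_eq_bot, ae_eq_bot, Measure.restrict_eq_zero] at this
    exact hv0 this
  have hfi : IntegrableOn f Ω := by
    have h1 : IntegrableOn (fun y => f y - f x0) Ω :=
      ⟨hfm.sub aestronglyMeasurable_const,
        (pt x0 hx0).trans_lt (ENNReal.mul_lt_top ENNReal.ofReal_lt_top hx0P)⟩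
    have h2 : IntegrableOn (fun _ : EE n => f x0) Ω := integrableOn_const hvt
    exact (h1.add h2).congr_fun (fun y _ => by simp) ho.measurableSet
  set c : ℝ := (v.toReal)⁻¹ * ∫ y in Ω, f y with hcdef
  have hvr : 0 < v.toReal := ENNReal.toReal_pos hv0 hvt
  have hpt2 : ∀ x ∈ Ω, ‖f x - c‖ₑ ≤ v⁻¹ * D * P x := by
    intro x hx
    have e1 : ∫ y in Ω, (f y - f x) = v.toReal * (c - f x) := by
      rw [integral_sub hfi (integrableOn_const hvt), setIntegral_const, smul_eq_mul, hcdef,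
        measureReal_def]
      field_simp
      rw [← hvdef]; ring
    have e2 : v * ‖f x - c‖ₑ ≤ D * P x := by
      refine le_trans ?_ (pt x hx)
      refine le_trans (le_of_eq ?_) (enorm_integral_le_lintegral_enorm _)
      rw [e1, enorm_mul, Real.enorm_of_nonneg hvr.le, ENNReal.ofReal_toReal hvt,
        ← enorm_neg (c - f x), neg_sub]
    calc ‖f x - c‖ₑ = v⁻¹ * (v * ‖f x - c‖ₑ) := by
          rw [← mul_assoc, ENNReal.inv_mul_cancel hv0 hvt, one_mul]
      _ ≤ v⁻¹ * (D * P x) := by gcongr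
      _ = _ := by ring
  -- Young
  set K : EE n → EE n → ℝ≥0∞ := fun x z => ‖z - x‖ₑ ^ (-α) with hKdef
  have hK : Measurable (Function.uncurry K) := by
    unfold Function.uncurry; simp only [K]; fun_prop
  set H := ENNReal.ofReal (n / (n - α) * unitBallVolume n * R ^ ((n:ℝ) - α))
  have hY := young (volume.restrict Ω) K hK (fun z => g z ^ q) (hg.pow_const q) (1 / r) (1 - 1 / q)
    (1 / q - 1 / r) h1r (by linarith) (by linarith) (by ring) H
    (fun x => rearr n hn Ω ho.measurableSet R α hR hV hα0 hαn x)
    (fun z => by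
      refine le_trans (le_of_eq ?_) (rearr n hn Ω ho.measurableSet R α hR hV hα0 hαn z)
      refine lintegral_congr fun x => ?_
      simp only [K]; rw [← enorm_neg, neg_sub])
  have ex1 : 1 / r + (1 - 1 / q) = 1 - 1 / q + 1 / r := by ring
  have ex2 : 1 / r + (1 / q - 1 / r) = 1 / q := by ring
  rw [ex1, ex2, one_div_one_div] at hY
  have ex3 : ∀ x z, K x z ^ (1 - 1 / q + 1 / r) * (g z ^ q) ^ (1 / q) = g z * k x z := by
    intro x z
    simp only [K, k]
    rw [← ENNReal.rpow_mul, ← ENNReal.rpow_mul, mul_one_div_cancel hq0.ne', ENNReal.rpow_one,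
      neg_mul, hα, mul_comm]
  simp_rw [ex3] at hY
  refine (iInf_le _ c).trans ?_
  calc (∫⁻ x in Ω, ‖f x - c‖ₑ ^ r) ^ (1 / r)
      ≤ (∫⁻ x in Ω, (v⁻¹ * D) ^ r * P x ^ r) ^ (1 / r) := by
        refine ENNReal.rpow_le_rpow ?_ h1r.le
        refine setLIntegral_mono' ho.measurableSet fun x hx => ?_
        rw [← ENNReal.mul_rpow_of_nonneg _ _ hr0.le]
        exact ENNReal.rpow_le_rpow (hpt2 x hx) hr0.le
    _ = v⁻¹ * D * (∫⁻ x in Ω, P x ^ r) ^ (1 / r) := by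
        rw [lintegral_const_mul _ (hPm.pow_const r), ENNReal.mul_rpow_of_nonneg _ _ h1r.le,
          ← ENNReal.rpow_mul, mul_one_div_cancel hr0.ne', ENNReal.rpow_one]
    _ ≤ v⁻¹ * D * (H ^ (1 - 1 / q + 1 / r) * (∫⁻ x in Ω, g x ^ q) ^ (1 / q)) := by
        gcongr
    _ = _ := by ring

lemma phi_lb (N s u k : ℝ) (hN : 0 < N) (hs : 0 ≤ s) (hsu : s ≤ u) (hk : 0 < k) :
    (Real.log N - Real.log k + 1 - 1 / k) + u * (Real.log N - Real.log k + 1 - N / k) ≤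
      (1 + s) * Real.log ((1 + s) / (1 / N + s)) := by
  have hc : Real.log N - Real.log k + 1 - N / k ≤ 0 := by
    have h := Real.log_le_sub_one_of_pos (div_pos hN hk)
    rw [Real.log_div hN.ne' hk.ne'] at h
    linarith
  have h1 : u * (Real.log N - Real.log k + 1 - N / k) ≤
      s * (Real.log N - Real.log k + 1 - N / k) := mul_le_mul_of_nonpos_right hsu hc
  have hy : 0 < (1 + N * s) / (1 + s) := by positivity
  have h2 := Real.log_le_sub_one_of_pos (div_pos hy hk)
  rw [Real.log_div hy.ne' hk.ne'] at h2
  have h3 : (1 + s) / (1 / N + s) = N / ((1 + N * s) / (1 + s)) := by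
    field_simp
  rw [h3, Real.log_div hN.ne' hy.ne']
  have h4 : (1 + s) * Real.log ((1 + N * s) / (1 + s)) ≤
      (1 + s) * ((1 + N * s) / (1 + s) / k - 1 + Real.log k) := by
    gcongr
    linarith
  have h5 : (1 + s) * ((1 + N * s) / (1 + s) / k - 1 + Real.log k) =
     (1 / k + s * (N / k)) - (1 + s) + (1 + s) * Real.log k := by
    field_simp
  nlinarith

lemma lin_ep (a b u p q : ℝ) (hp : p ≤ u) (hq : u ≤ q) (h1 : 0 ≤ a + b * p) (h2 : 0 ≤ a + b * q) :
    0 ≤ a + b * u := by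
  rcases le_total 0 b with hb | hb
  · nlinarith
  · nlinarith

lemma caseA (n : ℕ) (hn : 2 ≤ n) (u : ℝ) (h1 : 1 / (n:ℝ) ≤ u) (h2 : u ≤ 1 - 1 / (n:ℝ)) :
    ∃ k : ℝ, 0 < k ∧ 0 ≤ (Real.log n + 1 - Real.log k - 1 / k - 1 / 7) +
      (1 - Real.log k - n / k + n / 7) * u := by
  have l2a := Real.log_two_gt_d9
  have l2b := Real.log_two_lt_d9
  have l4 : Real.log 4 = 2 * Real.log 2 := by
    rw [show (4:ℝ) = 2 ^ 2 by norm_num, Real.log_pow]; norm_num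
  have l8 : Real.log 8 = 3 * Real.log 2 := by
    rw [show (8:ℝ) = 2 ^ 3 by norm_num, Real.log_pow]; norm_num
  have l3 : 19 * Real.log 2 ≤ 12 * Real.log 3 := by
    have := Real.log_le_log (by norm_num) (show (2:ℝ) ^ 19 ≤ 3 ^ 12 by norm_num)
    rw [Real.log_pow, Real.log_pow] at this; exact_mod_cast this
  have l5 : 23 * Real.log 2 ≤ 10 * Real.log 5 := by
    have := Real.log_le_log (by norm_num) (show (2:ℝ) ^ 23 ≤ 5 ^ 10 by norm_num)
    rw [Real.log_pow, Real.log_pow] at this; exact_mod_cast this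
  have l7 : 11 * Real.log 2 ≤ 4 * Real.log 7 := by
    have := Real.log_le_log (by norm_num) (show (2:ℝ) ^ 11 ≤ 7 ^ 4 by norm_num)
    rw [Real.log_pow, Real.log_pow] at this; exact_mod_cast this
  have l7' : 16 * Real.log 7 ≤ 45 * Real.log 2 := by
    have := Real.log_le_log (by norm_num) (show (7:ℝ) ^ 16 ≤ 2 ^ 45 by norm_num)
    rw [Real.log_pow, Real.log_pow] at this; exact_mod_cast this
  have l6 : Real.log 6 = Real.log 2 + Real.log 3 := by
    rw [← Real.log_mul (by norm_num) (by norm_num)]; norm_num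
  by_cases h9 : 9 ≤ n
  · refine ⟨7, by norm_num, ?_⟩
    have l9 : 2 * Real.log 3 ≤ Real.log n := by
      have := Real.log_le_log (by norm_num) (show (3:ℝ) ^ 2 ≤ n by
        norm_num; exact_mod_cast h9)
      rw [Real.log_pow] at this; exact_mod_cast this
    have hu1 : u ≤ 1 := h2.trans (by have : (0:ℝ) ≤ 1 / n := by positivity
                                     linarith)
    have hb : (1 - Real.log 7 - n / 7 + n / 7) ≤ 0 := by linarith
    nlinarith
  · have : n = 2 ∨ n = 3 ∨ n = 4 ∨ n = 5 ∨ n = 6 ∨ n = 7 ∨ n = 8 := by omega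
    rcases this with rfl | rfl | rfl | rfl | rfl | rfl | rfl
    · refine ⟨2, by norm_num, lin_ep _ _ _ _ _ h1 h2 ?_ ?_⟩ <;> norm_num <;> linarith
    · refine ⟨2, by norm_num, lin_ep _ _ _ _ _ h1 h2 ?_ ?_⟩ <;> norm_num <;> linarith
    · refine ⟨2, by norm_num, lin_ep _ _ _ _ _ h1 h2 ?_ ?_⟩ <;> norm_num <;> linarith
    · refine ⟨4, by norm_num, lin_ep _ _ _ _ _ h1 h2 ?_ ?_⟩ <;> norm_num <;> linarith
    · refine ⟨4, by norm_num, lin_ep _ _ _ _ _ h1 h2 ?_ ?_⟩ <;> norm_num <;> linarith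
    · refine ⟨4, by norm_num, lin_ep _ _ _ _ _ h1 h2 ?_ ?_⟩ <;> norm_num <;> linarith
    · refine ⟨4, by norm_num, lin_ep _ _ _ _ _ h1 h2 ?_ ?_⟩ <;> norm_num <;> linarith

lemma logineq (n : ℕ) (hn : 2 ≤ n) (L s σ : ℝ) (hL : 1 / 7 ≤ L) (hs : 0 ≤ s) (hsσ : s + σ ≤ 1)
    (hσ : 1 / (n:ℝ) ≤ σ) :
    (Real.log n + σ * (n * L - Real.log (n + 1)) ≤
      (1 + s) * Real.log ((1 + s) / (1 / n + s)) + (n - 1) * L) ∨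
    (Real.log n + σ * ((n - 1) * L) ≤
      (1 + s) * Real.log ((1 + s) / (1 / n + s)) + (n - 1) * L) := by
  have hn1 : (2:ℝ) ≤ n := by exact_mod_cast hn
  have hn0 : (0:ℝ) < n := by linarith
  obtain ⟨u, rfl⟩ : ∃ u, σ = 1 - u := ⟨1 - σ, by ring⟩
  have hsu : s ≤ u := by linarith
  have hu0 : 0 ≤ u := by linarith
  have hu1 : 0 ≤ 1 - u := le_trans (by positivity) hσ
  have hlog : Real.log n ≤ Real.log (n + 1) := Real.log_le_log hn0 (by linarith)
  have hln : 0 ≤ Real.log n := Real.log_nonneg (by linarith)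
  have hm := mul_le_mul_of_nonneg_left hlog hu1
  by_cases hA : 1 / (n:ℝ) ≤ u
  · left
    obtain ⟨k, hk, h⟩ := caseA n hn u hA (by linarith)
    have hp := phi_lb n s u k hn0 hs hsu hk
    have hnu : 0 ≤ n * u - 1 := by
      rw [div_le_iff₀ hn0] at hA; linarith
    have := mul_le_mul_of_nonneg_left hL hnu
    nlinarith
  · have hnu : n * u - 1 ≤ 0 := by
      push Not at hA
      rw [lt_div_iff₀ hn0] at hA; linarith
    have hp := phi_lb n s u 1 hn0 hs hsu one_pos
    simp only [Real.log_one, div_one] at hp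
    rcases le_total L 1 with h | h
    · left
      have h3 : 1 ≤ Real.log (n + 1) := by
        rw [Real.le_log_iff_exp_le (by linarith)]
        have := Real.exp_one_lt_d9
        linarith
      have := mul_le_mul_of_nonpos_left h hnu
      have h4 := mul_le_mul_of_nonneg_left h3 hu1
      have h5 := mul_nonneg hu0 hln
      nlinarith
    · right
      have h5 := mul_nonneg hu0 hln
      have h6 : (n - 1) * u ≤ (n - 1) * u * L := le_mul_of_one_le_right (by nlinarith) h
      nlinarith

lemma Mlem2 {n : ℕ} (hn : 2 ≤ n) {Ω : Set (EE n)} (ho : IsOpen Ω) (hc : Convex ℝ Ω)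
    (hb : Bornology.IsBounded Ω) (hd : 0 < Metric.diam Ω) (R : ℝ) (hR : 0 < R)
    (hV : volume Ω = ENNReal.ofReal (unitBallVolume n * R ^ n))
    {G : EE n → ℝ≥0∞} (hG : Measurable G) :
    ∫⁻ x in Ω, ∫⁻ y in Ω, ‖y - x‖ₑ * ∫⁻ τ in Set.Ioc (0:ℝ) 1, G (x + τ • (y - x)) ≤
      ENNReal.ofReal (Metric.diam Ω ^ n / n * (n * unitBallVolume n * R)) * ∫⁻ z in Ω, G z := by
  have hn1 : (2:ℝ) ≤ n := by exact_mod_cast hn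
  set k : EE n → EE n → ℝ≥0∞ := fun x z => ‖z - x‖ₑ ^ (-((n:ℝ) - 1)) with hk
  have hgk : Measurable (Function.uncurry fun x z => G z * k x z) := by
    unfold Function.uncurry; simp only [k]; fun_prop
  have hPm : Measurable fun x => ∫⁻ z in Ω, G z * k x z := Measurable.lintegral_prod_right hgk
  calc _ ≤ ∫⁻ x in Ω, ENNReal.ofReal (Metric.diam Ω ^ n / n) * ∫⁻ z in Ω, G z * k x z :=
        setLIntegral_mono' ho.measurableSet fun x hx => riesz hn ho hc hb hd hG hx
    _ = ENNReal.ofReal (Metric.diam Ω ^ n / n) * ∫⁻ z in Ω, G z * ∫⁻ x in Ω, k x z := by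
        rw [lintegral_const_mul _ hPm, lintegral_lintegral_swap hgk.aemeasurable]
        congr 1
        refine lintegral_congr fun z => ?_
        rw [lintegral_const_mul _ (by simp only [k]; fun_prop)]
    _ ≤ ENNReal.ofReal (Metric.diam Ω ^ n / n) *
          ∫⁻ z in Ω, G z * ENNReal.ofReal (n * unitBallVolume n * R) := by
        gcongr with z
        have := rearr n hn Ω ho.measurableSet R ((n:ℝ) - 1) hR hV (by linarith) (by linarith) z
        rw [_root_.sub_sub_cancel, div_one, Real.rpow_one] at this
        refine le_trans (le_of_eq ?_) this
        refine lintegral_congr fun x => ?_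
        simp only [k]; rw [← enorm_neg, neg_sub]
    _ = _ := by
        rw [lintegral_mul_const _ hG, ENNReal.ofReal_mul (p := Metric.diam Ω ^ n / n) (by positivity)]
        ring

lemma const_high (n : ℕ) (hn : 2 ≤ n) (w R d θ : ℝ) (hw : 0 < w) (hR : 0 < R) (hd : 0 < d)
    (hη : 0 < 1 / (n:ℝ) - 1 + θ) :
    (w * R ^ n)⁻¹ * (d ^ n / n) * (n / (n - (n - 1) / θ) * w * R ^ ((n:ℝ) - (n - 1) / θ)) ^ θ =
    (d ^ n / (n * (w * R ^ n))) * (θ / (1 / (n:ℝ) - 1 + θ)) ^ θ * w ^ (1 - 1 / (n:ℝ)) *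
      (w * R ^ n) ^ (1 / (n:ℝ) - 1 + θ) := by
  have hn1 : (2:ℝ) ≤ n := by exact_mod_cast hn
  have hn0 : (0:ℝ) < n := by linarith
  have hθ : 0 < θ := by
    have : 1 / (n:ℝ) ≤ 1 := by rw [div_le_one hn0]; linarith
    linarith
  have e1 : (n:ℝ) / (n - (n - 1) / θ) = θ / (1 / (n:ℝ) - 1 + θ) := by
    have h1 : (n:ℝ) - (n - 1) / θ = n * (1 / (n:ℝ) - 1 + θ) / θ := by
      field_simp; ring
    rw [h1]
    field_simp
  have e2 : ((n:ℝ) - (n - 1) / θ) * θ = n * (1 / (n:ℝ) - 1 + θ) := by field_simp; ring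
  rw [e1, Real.mul_rpow (by positivity) (by positivity), Real.mul_rpow (by positivity) hw.le,
    ← Real.rpow_mul hR.le, e2, Real.mul_rpow hw.le (by positivity), ← Real.rpow_natCast R n,
    ← Real.rpow_mul hR.le]
  have e3 : w ^ θ = w ^ (1 - 1 / (n:ℝ)) * w ^ (1 / (n:ℝ) - 1 + θ) := by
    rw [← Real.rpow_add hw]; congr 1; ring
  rw [e3]
  field_simp

lemma const_low (n : ℕ) (hn : 2 ≤ n) (w R d r q : ℝ) (hw : 0 < w) (hR : 0 < R) (hd : 0 < d)
    (hq1 : 1 ≤ q) (hqn : q ≤ n) (hr1 : 1 ≤ r) (hrq : r ≤ q)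
    (hL : 1 / 7 ≤ Real.log d - Real.log R) :
    (w * R ^ n) ^ (1 / r - 1 / q) *
      (d ^ (q - 1) * (w * d ^ (n + 1) / (n + 1)) / (w * R ^ n)) ^ (1 / q) ≤
    (d ^ n / (n * (w * R ^ n))) *
      ((1 - 1 / q + 1 / r) / (1 / (n:ℝ) - 1 / q + 1 / r)) ^ (1 - 1 / q + 1 / r) *
      w ^ (1 - 1 / (n:ℝ)) * (w * R ^ n) ^ (1 / (n:ℝ) - 1 / q + 1 / r) ∨
    (w * R ^ n) ^ (1 / r - 1 / q) *
      (d ^ (q - 1) * (d ^ n / n * (n * w * R)) / (w * R ^ n)) ^ (1 / q) ≤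
    (d ^ n / (n * (w * R ^ n))) *
      ((1 - 1 / q + 1 / r) / (1 / (n:ℝ) - 1 / q + 1 / r)) ^ (1 - 1 / q + 1 / r) *
      w ^ (1 - 1 / (n:ℝ)) * (w * R ^ n) ^ (1 / (n:ℝ) - 1 / q + 1 / r) := by
  have hn1 : (2:ℝ) ≤ n := by exact_mod_cast hn
  have hn0 : (0:ℝ) < n := by linarith
  have hq0 : 0 < q := by linarith
  have hr0 : 0 < r := by linarith
  have hs : 0 ≤ 1 / r - 1 / q := by
    have := one_div_le_one_div_of_le hr0 hrq
    linarith
  have hr' : 1 / r ≤ 1 := by rw [div_le_one hr0]; exact hr1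
  have hσ : 1 / (n:ℝ) ≤ 1 / q := one_div_le_one_div_of_le hq0 hqn
  have hσq : 1 / q * q = 1 := one_div_mul_cancel hq0.ne'
  have hni : 1 / (n:ℝ) * n = 1 := one_div_mul_cancel hn0.ne'
  have hni0 : 0 < 1 / (n:ℝ) := by positivity
  have key := logineq n hn (Real.log d - Real.log R) (1 / r - 1 / q) (1 / q) hL hs (by linarith) hσ
  have t1 : 1 + (1 / r - 1 / q) = 1 - 1 / q + 1 / r := by ring
  have t2 : 1 / (n:ℝ) + (1 / r - 1 / q) = 1 / (n:ℝ) - 1 / q + 1 / r := by ring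
  rw [t1, t2] at key
  have hθ : 0 < 1 - 1 / q + 1 / r := by linarith
  have hη : 0 < 1 / (n:ℝ) - 1 / q + 1 / r := by linarith
  have hv : 0 < w * R ^ n := by positivity
  have lv : Real.log (w * R ^ n) = Real.log w + n * Real.log R := by
    rw [Real.log_mul hw.ne' (by positivity), Real.log_pow]
  set σ := 1 / q
  set ρ := 1 / r
  set ν := 1 / (n:ℝ)
  have lK : Real.log ((d ^ n / (n * (w * R ^ n))) * ((1 - σ + ρ) / (ν - σ + ρ)) ^ (1 - σ + ρ) *
      w ^ (1 - ν) * (w * R ^ n) ^ (ν - σ + ρ)) =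
      n * Real.log d - (Real.log n + (Real.log w + n * Real.log R)) +
      (1 - σ + ρ) * Real.log ((1 - σ + ρ) / (ν - σ + ρ)) + (1 - ν) * Real.log w +
      (ν - σ + ρ) * (Real.log w + n * Real.log R) := by
    rw [Real.log_mul (by positivity) (by positivity), Real.log_mul (by positivity) (by positivity),
      Real.log_mul (by positivity) (by positivity), Real.log_div (by positivity) (by positivity),
      Real.log_mul (by positivity) (by positivity), lv, Real.log_rpow (by positivity),
      Real.log_rpow (by positivity), Real.log_rpow (by positivity), lv, Real.log_pow]
  rcases key with h | h
  · left
    rw [← Real.log_le_log_iff (by positivity) (by positivity), lK,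
      Real.log_mul (by positivity) (by positivity), Real.log_rpow hv, lv,
      Real.log_rpow (by positivity), Real.log_div (by positivity) (by positivity), lv,
      Real.log_mul (by positivity) (by positivity), Real.log_rpow hd,
      Real.log_div (by positivity) (by positivity), Real.log_mul (by positivity) (by positivity),
      Real.log_pow]
    push_cast
    have z1 : σ * q * Real.log d = Real.log d := by rw [hσq, one_mul]
    have z2 : ν * n * Real.log R = Real.log R := by rw [hni, one_mul]
    linarith
  · right
    rw [← Real.log_le_log_iff (by positivity) (by positivity), lK,
      Real.log_mul (by positivity) (by positivity), Real.log_rpow hv, lv,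
      Real.log_rpow (by positivity), Real.log_div (by positivity) (by positivity), lv,
      Real.log_mul (by positivity) (by positivity), Real.log_rpow hd,
      Real.log_mul (by positivity) (by positivity),
      Real.log_div (by positivity) (by positivity), Real.log_mul (by positivity) (by positivity),
      Real.log_mul (by positivity) (by positivity), Real.log_pow]
    have z1 : σ * q * Real.log d = Real.log d := by rw [hσq, one_mul]
    have z2 : ν * n * Real.log R = Real.log R := by rw [hni, one_mul]
    linarith

lemma Lbound (n : ℕ) (hn : 2 ≤ n) (w R d : ℝ) (hw : 0 < w) (hR : 0 < R) (hd : 0 < d)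
    (h : w * R ^ n ≤ w * (√3 / 2 * d) ^ n) : 1 / 7 ≤ Real.log d - Real.log R := by
  have h1 : R ≤ √3 / 2 * d :=
    le_of_pow_le_pow_left₀ (by omega) (by positivity) (le_of_mul_le_mul_left h hw)
  have h2 := Real.log_le_log hR h1
  rw [Real.log_mul (by positivity) (by positivity), Real.log_div (by positivity) (by positivity),
    Real.log_sqrt (by positivity)] at h2
  have h3 : 12 * Real.log 3 ≤ 20 * Real.log 2 := by
    have := Real.log_le_log (by norm_num) (show (3:ℝ) ^ 12 ≤ 2 ^ 20 by norm_num)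
    rw [Real.log_pow, Real.log_pow] at this; exact_mod_cast this
  have h4 : 41 * Real.log 3 ≤ 65 * Real.log 2 := by
    have := Real.log_le_log (by norm_num) (show (3:ℝ) ^ 41 ≤ 2 ^ 65 by norm_num)
    rw [Real.log_pow, Real.log_pow] at this; exact_mod_cast this
  have := Real.log_two_gt_d9
  linarith

end SPaux

/-- [GU16]: for a bounded convex domain `Ω ⊆ ℝⁿ` with diameter `d_Ω`,
the `(r,q)`-Sobolev–Poincaré inequality holds with constant at most
`(d_Ω^n/(n|Ω|)) ((1-1/q+1/r)/(1/n-1/q+1/r))^{1-1/q+1/r} ω_n^{1-1/n} |Ω|^{1/n-1/q+1/r}`. -/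
theorem convex_domain_Sobolev_Poincare_constant
    (n : ℕ) (hn : 2 ≤ n)
    (Ω : Set (EuclideanSpace ℝ (Fin n))) (hΩopen : IsOpen Ω) (hΩne : Ω.Nonempty)
    (hΩconv : Convex ℝ Ω) (hΩbdd : Bornology.IsBounded Ω)
    (r q : ℝ) (hq1 : 1 ≤ q) (hqn : q ≤ n) (hr1 : 1 ≤ r)
    (hadm : 0 < 1 / (n : ℝ) - 1 / q + 1 / r)
    (f : EuclideanSpace ℝ (Fin n) → ℝ) (hf : DifferentiableOn ℝ f Ω)
    (hfq : ∫⁻ x in Ω, ENNReal.ofReal (‖fderiv ℝ f x‖ ^ q) < ⊤) :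
    (⨅ c : ℝ, (∫⁻ x in Ω, ENNReal.ofReal (|f x - c| ^ r)) ^ (1 / r))
      ≤ ENNReal.ofReal
          ((Metric.diam Ω ^ (n : ℕ) / ((n : ℝ) * (volume Ω).toReal)) *
            ((1 - 1 / q + 1 / r) / (1 / (n : ℝ) - 1 / q + 1 / r)) ^ (1 - 1 / q + 1 / r) *
            unitBallVolume n ^ (1 - 1 / (n : ℝ)) *
            (volume Ω).toReal ^ (1 / (n : ℝ) - 1 / q + 1 / r))
        * (∫⁻ x in Ω, ENNReal.ofReal (‖fderiv ℝ f x‖ ^ q)) ^ (1 / q) := by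
  have hn1 : (2:ℝ) ≤ n := by exact_mod_cast hn
  have hn0 : (0:ℝ) < n := by linarith
  have hq0 : 0 < q := by linarith
  have hr0 : 0 < r := by linarith
  have hw := SPaux.ubv_pos n hn
  have hv0 : volume Ω ≠ 0 := (hΩopen.measure_pos volume hΩne).ne'
  have hvt : volume Ω ≠ ⊤ := hΩbdd.measure_lt_top.ne
  have hvr : 0 < (volume Ω).toReal := ENNReal.toReal_pos hv0 hvt
  have hlens := SPaux.lens hn hΩne hΩbdd
  have hd : 0 < Metric.diam Ω := by
    rcases (Metric.diam_nonneg (s := Ω)).lt_or_eq with h | h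
    · exact h
    · exfalso
      rw [← h, mul_zero, zero_pow (by omega), mul_zero, ENNReal.ofReal_zero] at hlens
      exact hv0 (le_antisymm hlens bot_le)
  obtain ⟨R, hR, hVR⟩ : ∃ R : ℝ, 0 < R ∧ (volume Ω).toReal = unitBallVolume n * R ^ n := by
    refine ⟨((volume Ω).toReal / unitBallVolume n) ^ (1 / (n:ℝ)), by positivity, ?_⟩
    rw [← Real.rpow_natCast, ← Real.rpow_mul (by positivity), one_div_mul_cancel hn0.ne',
      Real.rpow_one]
    field_simp
  have hV : volume Ω = ENNReal.ofReal (unitBallVolume n * R ^ n) := by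
    rw [← hVR, ENNReal.ofReal_toReal hvt]
  have hv : 0 < unitBallVolume n * R ^ n := by positivity
  have ec : ∀ c : ℝ, ∀ x, ENNReal.ofReal (|f x - c| ^ r) = ‖f x - c‖ₑ ^ r :=
    fun c x => SPaux.enorm_conv _ r hr0.le
  have eg : ∀ x, ENNReal.ofReal (‖fderiv ℝ f x‖ ^ q) = ‖fderiv ℝ f x‖ₑ ^ q := fun x => by
    rw [← ENNReal.ofReal_rpow_of_nonneg (norm_nonneg _) hq0.le, ofReal_norm]
  simp_rw [ec, eg]
  simp_rw [eg] at hfq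
  rw [hVR]
  rcases le_total q r with hqr | hrq
  · have hθ : 0 < 1 - 1 / q + 1 / r := by
      have : 1 / (n:ℝ) ≤ 1 := by rw [div_le_one hn0]; linarith
      linarith
    have h := SPaux.high hn hΩopen hΩconv hΩne hΩbdd hd hf hq1 hqr hadm R hR hV hfq
      (((n:ℝ) - 1) / (1 - 1 / q + 1 / r)) (div_mul_cancel₀ _ hθ.ne')
    refine h.trans (le_of_eq ?_)
    congr 1
    have t : 1 / (n:ℝ) - 1 / q + 1 / r = 1 / (n:ℝ) - 1 + (1 - 1 / q + 1 / r) := by ring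
    rw [t] at hadm ⊢
    rw [← SPaux.const_high n hn _ R _ _ hw hR hd hadm, hV, ← ENNReal.ofReal_inv_of_pos hv,
      ← ENNReal.ofReal_mul (by positivity), ENNReal.ofReal_rpow_of_nonneg _ hθ.le,
      ← ENNReal.ofReal_mul (by positivity)]
    have t2 : (n:ℝ) - (n - 1) / (1 - 1 / q + 1 / r) =
        n * (1 / (n:ℝ) - 1 + (1 - 1 / q + 1 / r)) / (1 - 1 / q + 1 / r) := by
      clear * - hθ hn0
      generalize 1 - 1 / q + 1 / r = θ at *
      field_simp; ring
    rw [t2]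
    positivity
  · have hL : 1 / 7 ≤ Real.log (Metric.diam Ω) - Real.log R := by
      refine SPaux.Lbound n hn (unitBallVolume n) R _ hw hR hd ?_
      rw [hV] at hlens
      exact (ENNReal.ofReal_le_ofReal_iff (by positivity)).1 hlens
    have hs : 0 ≤ 1 / r - 1 / q := by
      have := one_div_le_one_div_of_le hr0 hrq
      linarith
    have fin : ∀ m : ℝ, 0 ≤ m → (volume Ω) ^ (1 / r - 1 / q) *
        (ENNReal.ofReal (Metric.diam Ω ^ (q - 1)) * ENNReal.ofReal m / volume Ω) ^ (1 / q) =
        ENNReal.ofReal ((unitBallVolume n * R ^ n) ^ (1 / r - 1 / q) *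
          (Metric.diam Ω ^ (q - 1) * m / (unitBallVolume n * R ^ n)) ^ (1 / q)) := by
      intro m hm
      rw [hV, ← ENNReal.ofReal_mul (by positivity), ← ENNReal.ofReal_div_of_pos hv,
        ENNReal.ofReal_rpow_of_nonneg hv.le hs,
        ENNReal.ofReal_rpow_of_nonneg (by positivity) (by positivity),
        ← ENNReal.ofReal_mul (by positivity)]
    rcases SPaux.const_low n hn (unitBallVolume n) R (Metric.diam Ω) r q hw hR hd hq1 hqn hr1 hrq hL
      with h | h
    · have h1 := SPaux.low hΩopen hΩconv hΩne hΩbdd hf hr1 hrq _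
        (fun G hG => SPaux.Wlem hn hΩopen hΩconv hΩbdd hd hG)
      refine h1.trans ?_
      rw [fin _ (by positivity)]
      gcongr
    · have h1 := SPaux.low hΩopen hΩconv hΩne hΩbdd hf hr1 hrq _
        (fun G hG => SPaux.Mlem2 hn hΩopen hΩconv hΩbdd hd R hR hV hG)
      refine h1.trans ?_
      rw [fin _ (by positivity)]
      gcongr
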